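/- The edge-resilient strongly orientable blocks of a mixed graph G form a partition of its vertex set: every vertex belongs to exactly one edge-resilient strongly orientable block. -/

import Mathlib

/-- A directed multigraph: a type `E` of potential edges with source and target
maps, together with the set of edges actually present in the digraph. -/
structure MultiDigraph (V : Type) (E : Type) where
  edges : Set E
  src : E → V
  tgt : E → V

namespace MultiDigraph

variable {V E : Type}

/-- `G.IsWalk u v l` : the list of edges `l` forms a walk from `u` to `v`
(consecutive edges compose). -/
def IsWalk (G : MultiDigraph V E) : V → V → List E → Prop
  | u, v, [] => u = v
  | u, v, e :: l => e ∈ G.edges ∧ G.src e = u ∧ G.IsWalk (G.tgt e) v l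

/-- A path from `u` to `v`: a walk using no edge more than once. -/
def IsTrail (G : MultiDigraph V E) (u v : V) (l : List E) : Prop :=
  G.IsWalk u v l ∧ l.Nodup

/-- `u` reaches `v`: there is a path from `u` to `v`. -/
def Reaches (G : MultiDigraph V E) (u v : V) : Prop :=
  ∃ l : List E, G.IsTrail u v l

/-- `u` and `v` are strongly connected: each reaches the other. -/
def SConn (G : MultiDigraph V E) (u v : V) : Prop :=
  G.Reaches u v ∧ G.Reaches v u

/-- The digraph is strongly connected. -/
def StronglyConnected (G : MultiDigraph V E) : Prop :=
  ∀ u v : V, G.Reaches u v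

/-- Delete the edge `e`. -/
def deleteEdge (G : MultiDigraph V E) (e : E) : MultiDigraph V E :=
  { G with edges := G.edges \ {e} }

/-- A strong bridge: an edge whose deletion destroys strong connectivity. -/
def IsStrongBridge (G : MultiDigraph V E) (e : E) : Prop :=
  e ∈ G.edges ∧ ¬ (G.deleteEdge e).StronglyConnected

end MultiDigraph

/-- A mixed graph: a set of directed edges (with carrier `E`) and a set of
undirected edges (with carrier `F`, each with two endpoints). -/
structure MixedGraph (V E F : Type) where
  dEdges : Set E
  dsrc : E → V
  dtgt : E → V
  uEdges : Set F
  ufst : F → V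
  usnd : F → V

namespace MixedGraph

variable {V E F : Type}

/-- The orientation of `G` determined by a choice `o` of a direction for each
undirected edge: all directed edges are kept, and each undirected edge is
replaced by exactly one of its two possible directions. -/
def orient (G : MixedGraph V E F) (o : F → Bool) : MultiDigraph V (E ⊕ F) where
  edges := Sum.inl '' G.dEdges ∪ Sum.inr '' G.uEdges
  src := fun p =>
    match p with
    | Sum.inl e => G.dsrc e
    | Sum.inr f => if o f then G.ufst f else G.usnd f
  tgt := fun p =>
    match p with
    | Sum.inl e => G.dtgt e
    | Sum.inr f => if o f then G.usnd f else G.ufst f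

/-- Delete a directed edge of the mixed graph. -/
def delD (G : MixedGraph V E F) (e : E) : MixedGraph V E F :=
  { G with dEdges := G.dEdges \ {e} }

/-- Delete an undirected edge of the mixed graph. -/
def delU (G : MixedGraph V E F) (f : F) : MixedGraph V E F :=
  { G with uEdges := G.uEdges \ {f} }

end MixedGraph

namespace MixedGraph

variable {V E F : Type}

/-- For every (directed or undirected) edge `e` of `G` there is an orientation
of `G \ e` in which all vertices of `C` are pairwise strongly connected. -/
def EdgeResilient (G : MixedGraph V E F) (C : Set V) : Prop :=
  (∀ e ∈ G.dEdges, ∃ o : F → Bool,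
      ∀ a ∈ C, ∀ b ∈ C, ((G.delD e).orient o).SConn a b) ∧
  (∀ f ∈ G.uEdges, ∃ o : F → Bool,
      ∀ a ∈ C, ∀ b ∈ C, ((G.delU f).orient o).SConn a b)

/-- An edge-resilient strongly orientable block: a maximal edge-resilient set. -/
def IsERBlock (G : MixedGraph V E F) (C : Set V) : Prop :=
  G.EdgeResilient C ∧ ∀ C' : Set V, C ⊆ C' → G.EdgeResilient C' → C' = C

end MixedGraph

open Relation

namespace MultiDigraph

variable {V E : Type}

/-- There is an edge from `u` to `w`. -/
def Step (D : MultiDigraph V E) (u w : V) : Prop :=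
  ∃ e ∈ D.edges, D.src e = u ∧ D.tgt e = w

theorem IsWalk.of_append {D : MultiDigraph V E} {w : V} {l₂ : List E} :
    ∀ {l₁ : List E} {u : V}, D.IsWalk u w (l₁ ++ l₂) → ∃ x, D.IsWalk x w l₂
  | [], u, h => ⟨u, h⟩
  | _ :: _, _, h => IsWalk.of_append h.2.2

theorem Reaches.head {D : MultiDigraph V E} {u w x : V} (h : D.Step u w)
    (hr : D.Reaches w x) : D.Reaches u x := by
  obtain ⟨e, he, rfl, rfl⟩ := h
  obtain ⟨l, hw, hn⟩ := hr
  by_cases hel : e ∈ l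
  · obtain ⟨l₁, l₂, rfl⟩ := List.append_of_mem hel
    obtain ⟨y, hy⟩ := hw.of_append
    exact ⟨e :: l₂, ⟨he, rfl, hy.2.2⟩, (List.nodup_append.1 hn).2.1⟩
  · exact ⟨e :: l, ⟨he, rfl, hw⟩, List.nodup_cons.2 ⟨hel, hn⟩⟩

theorem IsWalk.reflTransGen {D : MultiDigraph V E} {w : V} :
    ∀ {l : List E} {u : V}, D.IsWalk u w l → ReflTransGen D.Step u w
  | [], _, h => by
    cases h
    exact .refl
  | e :: _, _, h => .head ⟨e, h.1, h.2.1, rfl⟩ (IsWalk.reflTransGen h.2.2)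

theorem reaches_iff_reflTransGen {D : MultiDigraph V E} {u w : V} :
    D.Reaches u w ↔ ReflTransGen D.Step u w := by
  refine ⟨fun ⟨_, h, _⟩ => h.reflTransGen, fun h => ?_⟩
  induction h using ReflTransGen.head_induction_on with
  | refl => exact ⟨[], rfl, List.nodup_nil⟩
  | head h _ ih => exact ih.head h

theorem Reaches.trans {D : MultiDigraph V E} {u w x : V} (h₁ : D.Reaches u w)
    (h₂ : D.Reaches w x) : D.Reaches u x := by
  rw [reaches_iff_reflTransGen] at *
  exact ReflTransGen.trans h₁ h₂

theorem SConn.symm {D : MultiDigraph V E} {u w : V} (h : D.SConn u w) : D.SConn w u :=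
  ⟨h.2, h.1⟩

theorem SConn.trans {D : MultiDigraph V E} {u w x : V} (h₁ : D.SConn u w)
    (h₂ : D.SConn w x) : D.SConn u x :=
  ⟨h₁.1.trans h₂.1, h₂.2.trans h₁.2⟩

end MultiDigraph

namespace MixedGraph

variable {V E F : Type}

open Classical in
/-- Each undirected edge is directed as in the first orientation (for a fixed well-order) in which
both its endpoints are strongly connected to `v`. -/
noncomputable def glue (H : MixedGraph V E F) (v : V) (f : F) : Bool :=
  if h : {o | (H.orient o).SConn v (H.ufst f) ∧ (H.orient o).SConn v (H.usnd f)}.Nonempty then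
    WellOrderingRel.isWellOrder.wf.min _ h f
  else true

theorem step_glue_or_exists_lt (H : MixedGraph V E F) {v y z : V} {o : F → Bool}
    (h : (H.orient o).Step y z) (hy : (H.orient o).SConn v y) (hz : (H.orient o).SConn v z) :
    (H.orient (H.glue v)).Step y z ∨
      ∃ p, WellOrderingRel p o ∧ (H.orient p).SConn v y ∧ (H.orient p).SConn v z := by
  obtain ⟨e | f, he, rfl, rfl⟩ := h
  · exact .inl ⟨.inl e, he, rfl, rfl⟩
  · by_cases hp : ∃ p, WellOrderingRel p o ∧
        (H.orient p).SConn v (H.ufst f) ∧ (H.orient p).SConn v (H.usnd f)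
    · obtain ⟨p, hpo, h₁, h₂⟩ := hp
      refine .inr ⟨p, hpo, ?_⟩
      cases hf : o f <;> simp [orient, hf] <;> tauto
    · left
      have hmem : (H.orient o).SConn v (H.ufst f) ∧ (H.orient o).SConn v (H.usnd f) := by
        cases hf : o f <;> simp [orient, hf] at hy hz <;> exact ⟨by assumption, by assumption⟩
      have hne : {o | (H.orient o).SConn v (H.ufst f) ∧
          (H.orient o).SConn v (H.usnd f)}.Nonempty := ⟨o, hmem⟩
      have hmin := WellOrderingRel.isWellOrder.wf.min_mem _ hne
      have hlt : ¬ WellOrderingRel o (WellOrderingRel.isWellOrder.wf.min _ hne) :=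
        WellOrderingRel.isWellOrder.wf.not_lt_min
          {o | (H.orient o).SConn v (H.ufst f) ∧ (H.orient o).SConn v (H.usnd f)} hmem
      have heq : WellOrderingRel.isWellOrder.wf.min _ hne = o := by
        rcases trichotomous_of WellOrderingRel (WellOrderingRel.isWellOrder.wf.min _ hne) o
          with h | h | h
        · exact absurd ⟨_, h, hmin⟩ hp
        · exact h
        · exact absurd h hlt
      have hg : H.glue v f = o f := by rw [glue, dif_pos hne, heq]
      exact ⟨.inr f, he, by simp [orient, hg], by simp [orient, hg]⟩

/-- A single orientation realises all strong connections to `v`. -/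
theorem sConn_glue (H : MixedGraph V E F) {v x : V} {o : F → Bool}
    (hx : (H.orient o).SConn v x) : (H.orient (H.glue v)).SConn v x := by
  induction o using WellOrderingRel.isWellOrder.wf.induction generalizing x with
  | _ o ih =>
  constructor
  · have key : ∀ y, ReflTransGen (H.orient o).Step v y → (H.orient o).Reaches y v →
        ReflTransGen (H.orient (H.glue v)).Step v y := by
      intro y hy
      induction hy with
      | refl => exact fun _ => .refl
      | @tail y z hvy hyz ihy =>
        intro hz
        have hy : (H.orient o).Reaches y v := hz.head hyz
        rw [← MultiDigraph.reaches_iff_reflTransGen] at hvy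
        have hvz : (H.orient o).Reaches v z :=
          hvy.trans (MultiDigraph.reaches_iff_reflTransGen.2 (.single hyz))
        rcases H.step_glue_or_exists_lt hyz ⟨hvy, hy⟩ ⟨hvz, hz⟩ with h | ⟨p, hp, -, h⟩
        · exact (ihy hy).tail h
        · exact MultiDigraph.reaches_iff_reflTransGen.1 (ih p hp h).1
    exact MultiDigraph.reaches_iff_reflTransGen.2
      (key x (MultiDigraph.reaches_iff_reflTransGen.1 hx.1) hx.2)
  · have key : ∀ y, ReflTransGen (H.orient o).Step y v → (H.orient o).Reaches v y →
        (H.orient (H.glue v)).Reaches y v := by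
      intro y hy
      induction hy using ReflTransGen.head_induction_on with
      | refl => exact fun _ => ⟨[], rfl, List.nodup_nil⟩
      | @head y z hyz hzv ihz =>
        intro hy
        rw [← MultiDigraph.reaches_iff_reflTransGen] at hzv
        have hvz : (H.orient o).Reaches v z :=
          hy.trans (MultiDigraph.reaches_iff_reflTransGen.2 (.single hyz))
        rcases H.step_glue_or_exists_lt hyz ⟨hy, hzv.head hyz⟩ ⟨hvz, hzv⟩ with h | ⟨p, hp, h, -⟩
        · exact (ihz hvz).head h
        · exact (ih p hp h).2
    exact key x (MultiDigraph.reaches_iff_reflTransGen.1 hx.2) hx.1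

/-- The vertices which, after deleting any edge, can be strongly connected to `v`. -/
def resilientClass (G : MixedGraph V E F) (v : V) : Set V :=
  {x | (∀ e ∈ G.dEdges, ∃ o, ((G.delD e).orient o).SConn v x) ∧
    ∀ f ∈ G.uEdges, ∃ o, ((G.delU f).orient o).SConn v x}

theorem mem_resilientClass_self (G : MixedGraph V E F) (v : V) : v ∈ G.resilientClass v := by
  have h : ∀ D : MultiDigraph V (E ⊕ F), D.SConn v v := fun _ =>
    ⟨⟨[], rfl, List.nodup_nil⟩, ⟨[], rfl, List.nodup_nil⟩⟩
  exact ⟨fun _ _ => ⟨fun _ => true, h _⟩, fun _ _ => ⟨fun _ => true, h _⟩⟩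

theorem edgeResilient_resilientClass (G : MixedGraph V E F) (v : V) :
    G.EdgeResilient (G.resilientClass v) := by
  refine ⟨fun e he => ⟨(G.delD e).glue v, fun a ha b hb => ?_⟩,
    fun f hf => ⟨(G.delU f).glue v, fun a ha b hb => ?_⟩⟩
  · obtain ⟨_, ha⟩ := ha.1 e he
    obtain ⟨_, hb⟩ := hb.1 e he
    exact (sConn_glue _ ha).symm.trans (sConn_glue _ hb)
  · obtain ⟨_, ha⟩ := ha.2 f hf
    obtain ⟨_, hb⟩ := hb.2 f hf
    exact (sConn_glue _ ha).symm.trans (sConn_glue _ hb)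

theorem EdgeResilient.subset_resilientClass {G : MixedGraph V E F} {C : Set V} {v : V}
    (hC : G.EdgeResilient C) (hv : v ∈ C) : C ⊆ G.resilientClass v := fun x hx =>
  ⟨fun e he => (hC.1 e he).imp fun _ h => h v hv x hx,
    fun f hf => (hC.2 f hf).imp fun _ h => h v hv x hx⟩

end MixedGraph

/-- The edge-resilient strongly orientable blocks of a mixed
graph `G` partition its vertex set: every vertex belongs to exactly one
edge-resilient strongly orientable block. -/
theorem statement_10 {V E F : Type} (G : MixedGraph V E F) (v : V) :
    ∃! C : Set V, v ∈ C ∧ G.IsERBlock C := by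
  refine ⟨G.resilientClass v, ⟨G.mem_resilientClass_self v, G.edgeResilient_resilientClass v,
    fun C' hC' hres => ?_⟩, fun C ⟨hv, hC, hmax⟩ => ?_⟩
  · exact (hres.subset_resilientClass (hC' (G.mem_resilientClass_self v))).antisymm hC'
  · exact (hmax _ (hC.subset_resilientClass hv) (G.edgeResilient_resilientClass v)).symm
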